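/- arXiv:2401.11693 — 8 statements merged into one kernel-verified Lean document; each statement's English description precedes it below -/
import Mathlib

section
/- Let f be a polynomial with real coefficients such that f(x) > 0 for every real x ≥ 0. Then there exist nonzero polynomials f₁ and f₂ with real coefficients such that f₁ has positive coefficients, f₂ has positive coefficients, and f · f₁ = f₂ (so that f = f₂/f₁ is a positive representation of f). -/
open Polynomial

/-- A real polynomial has positive coefficients if every coefficient in degrees
`0` through its degree is strictly positive. -/
def PosCoeffs (p : Polynomial ℝ) : Prop := ∀ i ≤ p.natDegree, 0 < p.coeff i

theorem PosCoeffs.ne_zero {p : ℝ[X]} (hp : PosCoeffs p) : p ≠ 0 := by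
  rintro rfl
  simpa using hp 0 (Nat.zero_le _)

theorem PosCoeffs.coeff_nonneg {p : ℝ[X]} (hp : PosCoeffs p) (i : ℕ) : 0 ≤ p.coeff i := by
  rcases le_or_gt i p.natDegree with h | h
  · exact (hp i h).le
  · exact (coeff_eq_zero_of_natDegree_lt h).ge

theorem PosCoeffs.mul {p q : ℝ[X]} (hp : PosCoeffs p) (hq : PosCoeffs q) :
    PosCoeffs (p * q) := by
  intro i hi
  rw [natDegree_mul hp.ne_zero hq.ne_zero] at hi
  rw [coeff_mul]
  refine Finset.sum_pos' (fun x _ ↦ mul_nonneg (hp.coeff_nonneg _) (hq.coeff_nonneg _))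
    ⟨(min i p.natDegree, i - min i p.natDegree), ?_, ?_⟩
  · rw [Finset.HasAntidiagonal.mem_antidiagonal]
    omega
  · exact mul_pos (hp _ (by omega)) (hq _ (by omega))

theorem posCoeffs_C {c : ℝ} (hc : 0 < c) : PosCoeffs (C c) := by
  intro i hi
  obtain rfl : i = 0 := by simpa using hi
  simpa using hc

theorem posCoeffs_X_add_C {a : ℝ} (ha : 0 < a) : PosCoeffs (X + C a) := by
  intro i hi
  rw [natDegree_X_add_C] at hi
  interval_cases i <;> simp [ha]

theorem posCoeffs_X_add_C_pow {a : ℝ} (ha : 0 < a) (n : ℕ) : PosCoeffs ((X + C a) ^ n) := by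
  induction n with
  | zero => simpa using posCoeffs_C one_pos
  | succ n ih => simpa only [pow_succ] using ih.mul (posCoeffs_X_add_C ha)

/-- A polynomial has a positive representation if some multiple of it by a polynomial with
positive coefficients has positive coefficients. -/
def HasPosRepr (f : ℝ[X]) : Prop := ∃ g, PosCoeffs g ∧ PosCoeffs (f * g)

theorem PosCoeffs.hasPosRepr {f : ℝ[X]} (hf : PosCoeffs f) : HasPosRepr f :=
  ⟨C 1, posCoeffs_C one_pos, by simpa using hf⟩

theorem HasPosRepr.mul {f g : ℝ[X]} (hf : HasPosRepr f) (hg : HasPosRepr g) :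
    HasPosRepr (f * g) := by
  obtain ⟨p, hp, hfp⟩ := hf
  obtain ⟨q, hq, hgq⟩ := hg
  exact ⟨p * q, hp.mul hq, by simpa only [mul_mul_mul_comm] using hfp.mul hgq⟩

theorem coeff_X_mul_derivative (p : ℝ[X]) (k : ℕ) :
    (X * derivative p).coeff k = k * p.coeff k := by
  cases k with
  | zero => simp
  | succ k => rw [coeff_X_mul, coeff_derivative]; push_cast; ring

/-- With `D = X * d/dX` and `G = (X + s) ^ (n + 2)`, a multiple of the product of a quadratic with
`(X + s) ^ n` is a combination of `G`, `D G` and `D (D G)`, so its coefficients are explicit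
multiples of those of `G`. -/
theorem coeff_quadratic_mul_X_add_C_pow (s β : ℝ) (n k : ℕ) :
    ((n : ℝ) + 2) * (n + 1) * ((X ^ 2 + C (β * s) * X + C (s ^ 2)) * (X + C s) ^ n).coeff k =
      ((k : ℝ) * (k - 1) + β * (k * (n + 2 - k)) + (n + 2 - k) * (n + 1 - k)) *
        ((X + C s) ^ (n + 2)).coeff k := by
  set G : ℝ[X] := (X + C s) ^ (n + 2) with hG
  have h1 : X * derivative G = C ((n : ℝ) + 2) * X * (X + C s) ^ (n + 1) := by
    rw [hG, derivative_X_add_C_pow]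
    simp
    ring
  have h2 : X * derivative (X * derivative G) = C ((n : ℝ) + 2) * X * (X + C s) ^ (n + 1) +
      C (((n : ℝ) + 2) * (n + 1)) * X ^ 2 * (X + C s) ^ n := by
    rw [h1, mul_assoc, derivative_C_mul, derivative_mul, derivative_X_add_C_pow]
    simp
    ring
  have key : C (((n : ℝ) + 2) * (n + 1)) *
        ((X ^ 2 + C (β * s) * X + C (s ^ 2)) * (X + C s) ^ n) =
      C (2 - β) * (X * derivative (X * derivative G)) +
        C (β * (n + 2) - 2 * (n + 2)) * (X * derivative G) + C (((n : ℝ) + 2) * (n + 1)) * G := by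
    rw [h2, h1, hG]
    simp only [map_mul, map_add, map_sub, map_pow, map_one, map_ofNat]
    ring
  rw [← coeff_C_mul, key]
  simp only [coeff_add, coeff_C_mul, coeff_X_mul_derivative]
  ring

theorem hasPosRepr_quadratic {s β : ℝ} (hs : 0 < s) (hβ : -2 < β) :
    HasPosRepr (X ^ 2 + C (β * s) * X + C (s ^ 2)) := by
  obtain ⟨δ, hδ, hδ1, hδβ⟩ : ∃ δ : ℝ, 0 < δ ∧ δ ≤ 1 ∧ δ ≤ β + 2 :=
    ⟨min 1 (β + 2), lt_min one_pos (by linarith), min_le_left _ _, min_le_right _ _⟩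
  obtain ⟨n, hn⟩ := exists_nat_gt (4 / δ)
  have hn' : 4 < n * δ := (div_lt_iff₀ hδ).1 hn
  refine ⟨(X + C s) ^ n, posCoeffs_X_add_C_pow hs n, fun k hk ↦ ?_⟩
  have hdeg : ((X ^ 2 + C (β * s) * X + C (s ^ 2)) * (X + C s) ^ n).natDegree ≤ n + 2 := by
    compute_degree
    omega
  have hk2 : k ≤ n + 2 := hk.trans hdeg
  have hG : 0 < ((X + C s) ^ (n + 2)).coeff k :=
    posCoeffs_X_add_C_pow hs (n + 2) k (by rwa [natDegree_pow, natDegree_X_add_C, mul_one])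
  have hkR : (k : ℝ) ≤ n + 2 := by exact_mod_cast hk2
  have h0 : (0 : ℝ) < ((n : ℝ) + 2) * (n + 1) := by positivity
  refine pos_of_mul_pos_right ?_ h0.le
  rw [coeff_quadratic_mul_X_add_C_pow]
  refine mul_pos ?_ hG
  obtain ⟨m, hm⟩ : ∃ m : ℝ, m = n + 2 - k := ⟨_, rfl⟩
  have hm0 : 0 ≤ m := by linarith
  have hkm : 0 ≤ (k : ℝ) * m := by positivity
  have h1 : (δ - 2) * (k * m) ≤ β * (k * m) := mul_le_mul_of_nonneg_right (by linarith) hkm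
  have h2 : 0 ≤ (1 - δ / 4) * ((k : ℝ) - m) ^ 2 := mul_nonneg (by linarith) (sq_nonneg _)
  have h3 : ((n : ℝ) + 2) * 4 < (n + 2) * ((n + 2) * δ) :=
    mul_lt_mul_of_pos_left (by linarith) (by positivity)
  have h4 : (n : ℝ) + 2 = k + m := by linarith
  have h5 : (n : ℝ) + 1 - k = m - 1 := by linarith
  rw [h5, ← hm]
  rw [h4] at h3
  linarith

theorem Irreducible.hasPosRepr {g : ℝ[X]} (hg : Irreducible g) (hm : g.Monic)
    (hroot : ∀ x, 0 ≤ x → g.eval x ≠ 0) : HasPosRepr g := by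
  have hle := hg.natDegree_le_two
  have hpos := hg.natDegree_pos
  obtain h | h : g.natDegree = 1 ∨ g.natDegree = 2 := by omega
  · have hgX := hm.eq_X_add_C h
    rw [hgX]
    refine (posCoeffs_X_add_C ?_).hasPosRepr
    by_contra! hc
    refine hroot (-g.coeff 0) (by linarith) ?_
    rw [hgX]
    simp
  · obtain ⟨b, c, rfl⟩ : ∃ b c : ℝ, g = X ^ 2 + C b * X + C c := by
      refine ⟨g.coeff 1, g.coeff 0, ?_⟩
      conv_lhs => rw [hm.as_sum, h]
      simp [Finset.sum_range_succ]
      ring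
    have hD : b ^ 2 < 4 * c := by
      by_contra! hD
      refine hg.not_isRoot_of_natDegree_ne_one (by omega) (x := (-b + √(b ^ 2 - 4 * c)) / 2) ?_
      have := Real.sq_sqrt (sub_nonneg.2 hD)
      simp only [IsRoot.def, eval_add, eval_mul, eval_pow, eval_X, eval_C]
      linear_combination this / 4
    have hc : 0 < c := by nlinarith [sq_nonneg b]
    have hs : 0 < √c := Real.sqrt_pos.2 hc
    have hsq : √c ^ 2 = c := Real.sq_sqrt hc.le
    have hb : -2 < b / √c := by
      rw [lt_div_iff₀ hs]
      nlinarith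
    simpa only [div_mul_cancel₀ b hs.ne', hsq] using hasPosRepr_quadratic hs hb

theorem eval_pos_of_monic_of_ne_zero {g : ℝ[X]} (hm : g.Monic)
    (hroot : ∀ x, 0 ≤ x → g.eval x ≠ 0) {x : ℝ} (hx : 0 ≤ x) : 0 < g.eval x := by
  by_contra! hneg
  rcases Nat.eq_zero_or_pos g.natDegree with h0 | hpos
  · rw [hm.natDegree_eq_zero.1 h0] at hneg
    norm_num at hneg
  · have ht := g.tendsto_atTop_of_leadingCoeff_nonneg (natDegree_pos_iff_degree_pos.1 hpos)
      (by rw [hm.leadingCoeff]; exact zero_le_one)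
    obtain ⟨y, hy, hxy⟩ :=
      ((ht.eventually_ge_atTop 0).and (Filter.eventually_ge_atTop x)).exists
    obtain ⟨z, hz, hz0⟩ := intermediate_value_Icc hxy g.continuous.continuousOn ⟨hneg, hy⟩
    exact hroot z (hx.trans hz.1) hz0

theorem hasPosRepr_of_eval_pos (f : ℝ[X]) (hf : ∀ x : ℝ, 0 ≤ x → 0 < f.eval x) :
    HasPosRepr f := by
  induction hn : f.natDegree using Nat.strong_induction_on generalizing f with
  | _ n ih =>
    rcases Nat.eq_zero_or_pos n with rfl | hpos
    · rw [eq_C_of_natDegree_eq_zero hn] at hf ⊢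
      exact (posCoeffs_C (by simpa using hf 0 le_rfl)).hasPosRepr
    · obtain ⟨g, hm, hg, h, rfl⟩ :=
        exists_monic_irreducible_factor f (not_isUnit_of_natDegree_pos f (hn ▸ hpos))
      have hroot : ∀ x, 0 ≤ x → g.eval x ≠ 0 := by
        intro x hx hgx
        simpa [hgx] using hf x hx
      have hh : h ≠ 0 := by
        rintro rfl
        simpa using hf 0 le_rfl
      rw [natDegree_mul hm.ne_zero hh] at hn
      refine (hg.hasPosRepr hm hroot).mul (ih h.natDegree (by have := hg.natDegree_pos; omega) h
        (fun x hx ↦ ?_) rfl)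
      have := hf x hx
      rw [eval_mul] at this
      exact pos_of_mul_pos_right this (eval_pos_of_monic_of_ne_zero hm hroot hx).le

/-- **Laguerre / Meissner.** If `f` is a real polynomial with `f x > 0` for all `x ≥ 0`,
then there are nonzero polynomials `f₁`, `f₂` with positive coefficients such that
`f * f₁ = f₂`, i.e. `f = f₂ / f₁` is a positive representation of `f`. -/
theorem positive_representation (f : Polynomial ℝ)
    (hf : ∀ x : ℝ, 0 ≤ x → 0 < f.eval x) :
    ∃ f₁ f₂ : Polynomial ℝ, f₁ ≠ 0 ∧ f₂ ≠ 0 ∧ PosCoeffs f₁ ∧ PosCoeffs f₂ ∧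
      f * f₁ = f₂ := by
  obtain ⟨g, hg, hfg⟩ := hasPosRepr_of_eval_pos f hf
  exact ⟨g, f * g, hg.ne_zero, hfg.ne_zero, hg, hfg, rfl⟩
end

section
/- For every real number φ and every natural number n, the following polynomial identity holds in ℝ[X]: (X² − 2·cos(φ)·X + 1) · (Σ_{k=0}^{n} sin((k+1)φ)·X^k) = sin(φ) − sin((n+2)φ)·X^{n+1} + sin((n+1)φ)·X^{n+2}. -/
open Polynomial

theorem sin_add_two_mul (t φ : ℝ) :
    Real.sin ((t + 2) * φ) = 2 * Real.cos φ * Real.sin ((t + 1) * φ) - Real.sin (t * φ) := by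
  have h₁ : (t + 2) * φ = (t + 1) * φ + φ := by ring
  have h₂ : t * φ = (t + 1) * φ - φ := by ring
  rw [h₁, h₂, Real.sin_add, Real.sin_sub]
  ring

/-- The telescoping identity behind Hurwitz's special solution: for any real `φ` and `n : ℕ`,
`(X² − 2cos(φ)X + 1) · (Σ_{k=0}^{n} sin((k+1)φ) X^k)
  = sin(φ) − sin((n+2)φ) X^{n+1} + sin((n+1)φ) X^{n+2}` in `ℝ[X]`. -/
theorem hurwitz_identity (φ : ℝ) (n : ℕ) :
    (X ^ 2 - C (2 * Real.cos φ) * X + 1) *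
      (∑ k ∈ Finset.range (n + 1), C (Real.sin (((k : ℝ) + 1) * φ)) * X ^ k) =
    C (Real.sin φ) - C (Real.sin (((n : ℝ) + 2) * φ)) * X ^ (n + 1)
      + C (Real.sin (((n : ℝ) + 1) * φ)) * X ^ (n + 2) := by
  induction n with
  | zero =>
    have h := sin_add_two_mul 0 φ
    simp only [zero_add, one_mul, zero_mul, Real.sin_zero, sub_zero] at h
    simp only [Finset.sum_range_one, Nat.cast_zero, zero_add, one_mul, h, C_mul]
    ring
  | succ n ih =>
    have h := sin_add_two_mul ((n : ℝ) + 1) φ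
    have e : (n : ℝ) + 1 + 1 = n + 2 := by ring
    rw [e] at h
    rw [Finset.sum_range_succ, mul_add, ih, Nat.cast_succ, h, e]
    simp only [C_sub, C_mul]
    ring
end

section
/- Let φ be a real number with φ > 0 and let n be a natural number such that (n+1)φ ≤ π ≤ (n+2)φ. Then every coefficient of the polynomial (X² − 2·cos(φ)·X + 1) · (Σ_{k=0}^{n} sin((k+1)φ)·X^k) is nonnegative, and every coefficient sin((k+1)φ), k = 0, …, n, of the second factor is nonnegative. -/
open Polynomial

/-- Multiplying `∑ sin((k+1)φ) X^k` by `X² − 2cos(φ)X + 1` leaves only three terms. -/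
theorem quadratic_mul_sum_sin (φ : ℝ) (n : ℕ) :
    (X ^ 2 - C (2 * Real.cos φ) * X + 1) *
        (∑ k ∈ Finset.range (n + 1), C (Real.sin (((k : ℝ) + 1) * φ)) * X ^ k) =
      C (Real.sin φ) + C (-Real.sin (((n : ℝ) + 2) * φ)) * X ^ (n + 1) +
        C (Real.sin (((n : ℝ) + 1) * φ)) * X ^ (n + 2) := by
  induction n with
  | zero =>
    have h : Real.sin (2 * φ) = 2 * Real.cos φ * Real.sin φ := by
      rw [Real.sin_two_mul]; ring
    simp only [zero_add, Finset.sum_range_one, Nat.cast_zero, one_mul, h, C_neg, C_mul]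
    ring
  | succ n ih =>
    have h : Real.sin (((n : ℝ) + 3) * φ) =
        2 * Real.cos φ * Real.sin (((n : ℝ) + 2) * φ) - Real.sin (((n : ℝ) + 1) * φ) := by
      rw [show ((n : ℝ) + 3) * φ = ((n : ℝ) + 2) * φ + φ by ring,
        show ((n : ℝ) + 1) * φ = ((n : ℝ) + 2) * φ - φ by ring, Real.sin_add, Real.sin_sub]
      ring
    rw [Finset.sum_range_succ, mul_add, ih]
    push_cast
    rw [show (n : ℝ) + 1 + 2 = n + 3 by ring, show (n : ℝ) + 1 + 1 = n + 2 by ring, h]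
    simp only [C_neg, C_mul, C_sub]
    ring

/-- **Hurwitz's special solution.** If `φ > 0` and `(n+1)φ ≤ π ≤ (n+2)φ`, then all
coefficients of `(X² − 2cos(φ)X + 1) · (Σ_{k=0}^{n} sin((k+1)φ) X^k)` are nonnegative,
and so are the coefficients `sin((k+1)φ)`, `k = 0, …, n`, of the second factor. -/
theorem hurwitz_nonneg (φ : ℝ) (n : ℕ) (hφ : 0 < φ)
    (h₁ : ((n : ℝ) + 1) * φ ≤ Real.pi) (h₂ : Real.pi ≤ ((n : ℝ) + 2) * φ) :
    (∀ i : ℕ, 0 ≤ ((X ^ 2 - C (2 * Real.cos φ) * X + 1) *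
        (∑ k ∈ Finset.range (n + 1), C (Real.sin (((k : ℝ) + 1) * φ)) * X ^ k)).coeff i) ∧
    (∀ k : ℕ, k ≤ n → 0 ≤ Real.sin (((k : ℝ) + 1) * φ)) := by
  have hs : ∀ k : ℕ, k ≤ n → 0 ≤ Real.sin (((k : ℝ) + 1) * φ) := fun k hk ↦ by
    have hk' : (k : ℝ) ≤ n := by exact_mod_cast hk
    exact Real.sin_nonneg_of_nonneg_of_le_pi (by positivity)
      (le_trans (by gcongr) h₁)
  refine ⟨fun i ↦ ?_, hs⟩
  have h0 : 0 ≤ Real.sin φ := by simpa using hs 0 n.zero_le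
  have h2 : 0 ≤ -Real.sin (((n : ℝ) + 2) * φ) := by
    rw [← Real.sin_sub_pi]
    have hn : 0 ≤ (n : ℝ) * φ := by positivity
    exact Real.sin_nonneg_of_nonneg_of_le_pi (by linarith) (by linarith)
  rw [quadratic_mul_sum_sin, coeff_add, coeff_add, coeff_C, coeff_C_mul_X_pow,
    coeff_C_mul_X_pow]
  have h1 := hs n le_rfl
  refine add_nonneg (add_nonneg ?_ ?_) ?_ <;> split_ifs <;> first | assumption | exact le_rfl
end

section
/- Let φ be a real number with 0 < φ < π, let a be a real number, and let p : ℝ → ℝ be twice continuously differentiable on the interval [a−φ, a+φ] with p(t) + p''(t) > 0 for all t ∈ [a−φ, a+φ]. Then p(a−φ) + p(a+φ) − 2·cos(φ)·p(a) > 0. -/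
/-- **Comparison lemma.** Let `0 < φ < π`, let `p` be twice continuously differentiable
on `[a−φ, a+φ]` (with first and second derivatives `p'`, `p''` there, `p''` continuous),
and suppose `p t + p'' t > 0` for all `t` in `[a−φ, a+φ]`. Then
`p(a−φ) + p(a+φ) − 2 cos(φ) p(a) > 0`. -/
theorem support_function_inequality (φ a : ℝ) (hφ₀ : 0 < φ) (hφ₁ : φ < Real.pi)
    (p p' p'' : ℝ → ℝ)
    (hp' : ∀ t ∈ Set.Icc (a - φ) (a + φ), HasDerivAt p (p' t) t)
    (hp'' : ∀ t ∈ Set.Icc (a - φ) (a + φ), HasDerivAt p' (p'' t) t)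
    (hcont : ContinuousOn p'' (Set.Icc (a - φ) (a + φ)))
    (hpos : ∀ t ∈ Set.Icc (a - φ) (a + φ), 0 < p t + p'' t) :
    0 < p (a - φ) + p (a + φ) - 2 * Real.cos φ * p a := by
  set G : ℝ → ℝ := fun s => (p' (a + s) - p' (a - s)) * Real.sin (φ - s)
    + (p (a + s) + p (a - s)) * Real.cos (φ - s) with hG
  have hderiv : ∀ s ∈ Set.Icc 0 φ, HasDerivAt G
      (((p (a + s) + p'' (a + s)) + (p (a - s) + p'' (a - s))) * Real.sin (φ - s)) s := by
    rintro s ⟨hs₀, hs₁⟩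
    have hadd : a + s ∈ Set.Icc (a - φ) (a + φ) := ⟨by linarith, by linarith⟩
    have hsub : a - s ∈ Set.Icc (a - φ) (a + φ) := ⟨by linarith, by linarith⟩
    have h := ((((hp'' _ hadd).comp_const_add a s).sub
      ((hp'' _ hsub).comp_const_sub a s)).mul
        ((Real.hasDerivAt_sin (φ - s)).comp_const_sub φ s)).add
      ((((hp' _ hadd).comp_const_add a s).add
        ((hp' _ hsub).comp_const_sub a s)).mul
          ((Real.hasDerivAt_cos (φ - s)).comp_const_sub φ s))
    refine h.congr_deriv ?_
    simp only [Pi.add_apply, Pi.sub_apply]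
    ring
  have hmono : StrictMonoOn G (Set.Icc 0 φ) := by
    refine strictMonoOn_of_deriv_pos (convex_Icc 0 φ)
      (fun s hs => (hderiv s hs).continuousAt.continuousWithinAt) fun s hs => ?_
    rw [interior_Icc] at hs
    rw [(hderiv s (Set.Ioo_subset_Icc_self hs)).deriv]
    obtain ⟨hs₀, hs₁⟩ := hs
    exact mul_pos
      (add_pos (hpos _ ⟨by linarith, by linarith⟩) (hpos _ ⟨by linarith, by linarith⟩))
      (Real.sin_pos_of_pos_of_lt_pi (by linarith) (by linarith))
  have hlt := hmono (Set.left_mem_Icc.2 hφ₀.le) (Set.right_mem_Icc.2 hφ₀.le) hφ₀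
  simp only [hG, add_zero, sub_zero, sub_self, Real.sin_zero, Real.cos_zero] at hlt
  linarith
end

section
/- Let φ ∈ (0, π/2), let n be a natural number, set u₁ = (n+2)φ, and let p : ℝ → ℝ be twice continuously differentiable on [0, u₁] with p(u) + p''(u) > 0 for all u ∈ [0, u₁], p(0) = 0, p(u₁) = 0, and p(u) > 0 for all u ∈ (0, u₁). Define a_{−1} = 0, a_{n+1} = 0, and a_k = p((k+1)φ) for k = 0, 1, …, n. Then a_k > 0 for k = 0, …, n, and a_{k−1} + a_{k+1} − 2a_k·cos(φ) > 0 for k = 0, 1, …, n. -/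
/-- The derivative of `p' t * sin (b - t) + p t * cos (b - t)` is `(p + p'') t * sin (b - t)`. -/
theorem hasDerivAt_mul_sin_add_mul_cos {p p' : ℝ → ℝ} {q b t : ℝ}
    (hp : HasDerivAt p (p' t) t) (hp' : HasDerivAt p' q t) :
    HasDerivAt (fun s => p' s * Real.sin (b - s) + p s * Real.cos (b - s))
      ((p t + q) * Real.sin (b - t)) t := by
  have hb : HasDerivAt (fun s : ℝ => b - s) (-1) t := by
    simpa using (hasDerivAt_id t).const_sub b
  refine ((hp'.mul hb.sin).add (hp.mul hb.cos)).congr_deriv ?_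
  ring

/-- If `p + p'' > 0` on `[c, b]` and `b - c ≤ π`, then `p b` exceeds the value at `b` of the
solution of `y + y'' = 0` with the same first-order data as `p` at `c`. -/
theorem deriv_mul_sin_add_mul_cos_lt_right {p p' p'' : ℝ → ℝ} {c b : ℝ} (hcb : c < b)
    (hπ : b - c ≤ Real.pi)
    (hp' : ∀ u ∈ Set.Icc c b, HasDerivAt p (p' u) u)
    (hp'' : ∀ u ∈ Set.Icc c b, HasDerivAt p' (p'' u) u)
    (hpos : ∀ u ∈ Set.Icc c b, 0 < p u + p'' u) :
    p' c * Real.sin (b - c) + p c * Real.cos (b - c) < p b := by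
  have hd := fun u hu => hasDerivAt_mul_sin_add_mul_cos (b := b) (hp' u hu) (hp'' u hu)
  have hmono := strictMonoOn_of_deriv_pos (convex_Icc c b)
    (fun u hu => (hd u hu).continuousAt.continuousWithinAt) fun u hu => by
      have hu' := interior_subset hu
      rw [interior_Icc] at hu
      rw [(hd u hu').deriv]
      exact mul_pos (hpos u hu')
        (Real.sin_pos_of_pos_of_lt_pi (by linarith [hu.2]) (by linarith [hu.1]))
  simpa using hmono (Set.left_mem_Icc.2 hcb.le) (Set.right_mem_Icc.2 hcb.le) hcb

/-- If `p + p'' > 0` on `[b, c]` and `c - b ≤ π`, then `p b` exceeds the value at `b` of the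
solution of `y + y'' = 0` with the same first-order data as `p` at `c`. -/
theorem deriv_mul_sin_add_mul_cos_lt_left {p p' p'' : ℝ → ℝ} {c b : ℝ} (hbc : b < c)
    (hπ : c - b ≤ Real.pi)
    (hp' : ∀ u ∈ Set.Icc b c, HasDerivAt p (p' u) u)
    (hp'' : ∀ u ∈ Set.Icc b c, HasDerivAt p' (p'' u) u)
    (hpos : ∀ u ∈ Set.Icc b c, 0 < p u + p'' u) :
    p' c * Real.sin (b - c) + p c * Real.cos (b - c) < p b := by
  have hd := fun u hu => hasDerivAt_mul_sin_add_mul_cos (b := b) (hp' u hu) (hp'' u hu)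
  have hanti := strictAntiOn_of_deriv_neg (convex_Icc b c)
    (fun u hu => (hd u hu).continuousAt.continuousWithinAt) fun u hu => by
      have hu' := interior_subset hu
      rw [interior_Icc] at hu
      rw [(hd u hu').deriv]
      exact mul_neg_of_pos_of_neg (hpos u hu')
        (Real.sin_neg_of_neg_of_neg_pi_lt (by linarith [hu.1]) (by linarith [hu.2]))
  simpa using hanti (Set.left_mem_Icc.2 hbc.le) (Set.right_mem_Icc.2 hbc.le) hbc

/-- If `p + p'' > 0` on `[c - h, c + h]` with `0 < h ≤ π`, then
`2 p(c) cos h < p(c - h) + p(c + h)`. -/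
theorem two_mul_mul_cos_lt_add {p p' p'' : ℝ → ℝ} {c h : ℝ} (hh : 0 < h) (hπ : h ≤ Real.pi)
    (hp' : ∀ u ∈ Set.Icc (c - h) (c + h), HasDerivAt p (p' u) u)
    (hp'' : ∀ u ∈ Set.Icc (c - h) (c + h), HasDerivAt p' (p'' u) u)
    (hpos : ∀ u ∈ Set.Icc (c - h) (c + h), 0 < p u + p'' u) :
    2 * p c * Real.cos h < p (c - h) + p (c + h) := by
  have hsr : Set.Icc c (c + h) ⊆ Set.Icc (c - h) (c + h) :=
    Set.Icc_subset_Icc_left (by linarith)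
  have hsl : Set.Icc (c - h) c ⊆ Set.Icc (c - h) (c + h) :=
    Set.Icc_subset_Icc_right (by linarith)
  have hr := deriv_mul_sin_add_mul_cos_lt_right (by linarith : c < c + h) (by linarith)
    (fun u hu => hp' u (hsr hu)) (fun u hu => hp'' u (hsr hu)) fun u hu => hpos u (hsr hu)
  have hl := deriv_mul_sin_add_mul_cos_lt_left (by linarith : c - h < c) (by linarith)
    (fun u hu => hp' u (hsl hu)) (fun u hu => hp'' u (hsl hu)) fun u hu => hpos u (hsl hu)
  rw [add_sub_cancel_left] at hr
  rw [sub_sub_cancel_left, Real.sin_neg, Real.cos_neg] at hl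
  linarith

/-- **From the differential inequality to the discrete system.** Let `0 < φ < π/2`,
`u₁ = (n+2)φ`, and let `p` be twice continuously differentiable on `[0, u₁]` with
`p + p'' > 0` there, `p 0 = 0`, `p u₁ = 0` and `p > 0` on `(0, u₁)`. Setting
`a₋₁ = 0`, `a_{n+1} = 0` and `a_k = p((k+1)φ)` for `k = 0, …, n`, one has `a_k > 0`
and `a_{k−1} + a_{k+1} − 2 a_k cos(φ) > 0` for all `k = 0, …, n`. -/
theorem support_function_solves_system (φ : ℝ) (hφ₀ : 0 < φ) (hφ₁ : φ < Real.pi / 2)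
    (n : ℕ) (u₁ : ℝ) (hu₁ : u₁ = ((n : ℝ) + 2) * φ)
    (p p' p'' : ℝ → ℝ)
    (hp' : ∀ u ∈ Set.Icc 0 u₁, HasDerivAt p (p' u) u)
    (hp'' : ∀ u ∈ Set.Icc 0 u₁, HasDerivAt p' (p'' u) u)
    (hcont : ContinuousOn p'' (Set.Icc 0 u₁))
    (hpos : ∀ u ∈ Set.Icc 0 u₁, 0 < p u + p'' u)
    (h0 : p 0 = 0) (h1 : p u₁ = 0)
    (hppos : ∀ u ∈ Set.Ioo 0 u₁, 0 < p u)
    (a : ℤ → ℝ) (ham : a (-1) = 0) (hap : a ((n : ℤ) + 1) = 0)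
    (hak : ∀ k : ℤ, 0 ≤ k → k ≤ (n : ℤ) → a k = p (((k : ℝ) + 1) * φ)) :
    (∀ k : ℤ, 0 ≤ k → k ≤ (n : ℤ) → 0 < a k) ∧
    (∀ k : ℤ, 0 ≤ k → k ≤ (n : ℤ) →
      0 < a (k - 1) + a (k + 1) - 2 * a k * Real.cos φ) := by
  have hk : ∀ k : ℤ, -1 ≤ k → k ≤ (n : ℤ) + 1 → a k = p (((k : ℝ) + 1) * φ) := by
    intro k hk0 hkn
    rcases hk0.eq_or_lt with rfl | hk0
    · simp [ham, h0]
    rcases hkn.eq_or_lt with rfl | hkn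
    · rw [hap, ← h1, hu₁]
      push_cast
      congr 1
      ring
    · exact hak k (by lia) (by lia)
  refine ⟨fun k hk0 hkn => ?_, fun k hk0 hkn => ?_⟩
  all_goals
    have hk0' : (0 : ℝ) ≤ k := by exact_mod_cast hk0
    have hkn' : (k : ℝ) ≤ n := by exact_mod_cast hkn
  · rw [hak k hk0 hkn]
    refine hppos _ ⟨by positivity, ?_⟩
    rw [hu₁]
    exact mul_lt_mul_of_pos_right (by linarith) hφ₀
  · have hs : Set.Icc (((k : ℝ) + 1) * φ - φ) (((k : ℝ) + 1) * φ + φ) ⊆ Set.Icc 0 u₁ := by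
      refine Set.Icc_subset_Icc ?_ ?_
      · nlinarith
      · rw [hu₁]
        nlinarith
    have key := two_mul_mul_cos_lt_add hφ₀ (by linarith [Real.pi_pos])
      (fun u hu => hp' u (hs hu)) (fun u hu => hp'' u (hs hu)) fun u hu => hpos u (hs hu)
    rw [hk (k - 1) (by lia) (by lia), hk (k + 1) (by lia) (by lia), hak k hk0 hkn]
    have hl : (((k - 1 : ℤ) : ℝ) + 1) * φ = ((k : ℝ) + 1) * φ - φ := by
      push_cast
      ring
    have hr : (((k + 1 : ℤ) : ℝ) + 1) * φ = ((k : ℝ) + 1) * φ + φ := by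
      push_cast
      ring
    rw [hl, hr]
    linarith
end

section
/- Let ρ : ℝ → ℝ be a continuous function with ρ(u) > 0 for all u. Then there exist a real number u₁ > 0 and a twice continuously differentiable function p : ℝ → ℝ such that p(u) + p''(u) = ρ(u) for all u ∈ [0, u₁], p(0) = 0, p(u₁) = 0, and p(u) > 0 for all u ∈ (0, u₁). -/
/-- The solution of `p + p'' = ρ` with `p 0 = 0` and `p' 0 = a`, by variation of constants. -/
noncomputable def supportSolution (ρ : ℝ → ℝ) (a u : ℝ) : ℝ :=
  Real.sin u * (a + ∫ t in (0 : ℝ)..u, Real.cos t * ρ t) -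
    Real.cos u * ∫ t in (0 : ℝ)..u, Real.sin t * ρ t

/-- The derivative of `supportSolution ρ a`. -/
noncomputable def supportSolutionDeriv (ρ : ℝ → ℝ) (a u : ℝ) : ℝ :=
  Real.cos u * (a + ∫ t in (0 : ℝ)..u, Real.cos t * ρ t) +
    Real.sin u * ∫ t in (0 : ℝ)..u, Real.sin t * ρ t

theorem hasDerivAt_supportSolution {ρ : ℝ → ℝ} (hρ : Continuous ρ) (a u : ℝ) :
    HasDerivAt (supportSolution ρ a) (supportSolutionDeriv ρ a u) u := by
  have hA := (Real.continuous_cos.mul hρ).integral_hasStrictDerivAt 0 u |>.hasDerivAt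
  have hB := (Real.continuous_sin.mul hρ).integral_hasStrictDerivAt 0 u |>.hasDerivAt
  refine (((Real.hasDerivAt_sin u).mul (hA.const_add a)).sub
    ((Real.hasDerivAt_cos u).mul hB)).congr_deriv ?_
  simp only [supportSolutionDeriv, Pi.mul_apply]
  ring

theorem hasDerivAt_supportSolutionDeriv {ρ : ℝ → ℝ} (hρ : Continuous ρ) (a u : ℝ) :
    HasDerivAt (supportSolutionDeriv ρ a) (ρ u - supportSolution ρ a u) u := by
  have hA := (Real.continuous_cos.mul hρ).integral_hasStrictDerivAt 0 u |>.hasDerivAt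
  have hB := (Real.continuous_sin.mul hρ).integral_hasStrictDerivAt 0 u |>.hasDerivAt
  refine (((Real.hasDerivAt_cos u).mul (hA.const_add a)).add
    ((Real.hasDerivAt_sin u).mul hB)).congr_deriv ?_
  simp only [supportSolution, Pi.mul_apply]
  linear_combination ρ u * Real.sin_sq_add_cos_sq u

theorem continuous_supportSolution {ρ : ℝ → ℝ} (hρ : Continuous ρ) (a : ℝ) :
    Continuous (supportSolution ρ a) :=
  continuous_iff_continuousAt.2 fun u => (hasDerivAt_supportSolution hρ a u).continuousAt

theorem deriv_supportSolution {ρ : ℝ → ℝ} (hρ : Continuous ρ) (a : ℝ) :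
    deriv (supportSolution ρ a) = supportSolutionDeriv ρ a :=
  funext fun u => (hasDerivAt_supportSolution hρ a u).deriv

theorem deriv_supportSolutionDeriv {ρ : ℝ → ℝ} (hρ : Continuous ρ) (a : ℝ) :
    deriv (supportSolutionDeriv ρ a) = fun u => ρ u - supportSolution ρ a u :=
  funext fun u => (hasDerivAt_supportSolutionDeriv hρ a u).deriv

theorem contDiff_supportSolution {ρ : ℝ → ℝ} (hρ : Continuous ρ) (a : ℝ) :
    ContDiff ℝ 2 (supportSolution ρ a) := by
  rw [show (2 : WithTop ℕ∞) = 1 + 1 by norm_num, contDiff_succ_iff_deriv]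
  refine ⟨fun u => (hasDerivAt_supportSolution hρ a u).differentiableAt, by simp, ?_⟩
  rw [deriv_supportSolution hρ, contDiff_one_iff_deriv, deriv_supportSolutionDeriv hρ]
  exact ⟨fun u => (hasDerivAt_supportSolutionDeriv hρ a u).differentiableAt,
    hρ.sub (continuous_supportSolution hρ a)⟩

theorem supportSolution_eq {ρ : ℝ → ℝ} (hρ : Continuous ρ) (a u : ℝ) :
    supportSolution ρ a u =
      a * Real.sin u + ∫ t in (0 : ℝ)..u, Real.sin (u - t) * ρ t := by
  have h : ∀ t, Real.sin (u - t) * ρ t =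
      Real.sin u * (Real.cos t * ρ t) - Real.cos u * (Real.sin t * ρ t) := fun t => by
    rw [Real.sin_sub]
    ring
  simp only [h]
  rw [intervalIntegral.integral_sub
      (Continuous.intervalIntegrable (by fun_prop) _ _)
      (Continuous.intervalIntegrable (by fun_prop) _ _),
    intervalIntegral.integral_const_mul, intervalIntegral.integral_const_mul, supportSolution]
  ring

theorem supportSolution_pos {ρ : ℝ → ℝ} (hρc : Continuous ρ) (hρ : ∀ u, 0 < ρ u)
    {a u : ℝ} (ha : 0 ≤ a) (hu : 0 < u) (huπ : u ≤ Real.pi) : 0 < supportSolution ρ a u := by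
  rw [supportSolution_eq hρc]
  refine add_pos_of_nonneg_of_pos
    (mul_nonneg ha (Real.sin_nonneg_of_nonneg_of_le_pi hu.le huπ)) ?_
  refine intervalIntegral.intervalIntegral_pos_of_pos_on
    (Continuous.intervalIntegrable (by fun_prop) _ _) (fun t ht => ?_) hu
  exact mul_pos (Real.sin_pos_of_pos_of_lt_pi (by linarith [ht.2]) (by linarith [ht.1])) (hρ t)

/-- A continuous function that is positive at `a` and negative at `b` has a first zero
in between. -/
theorem exists_first_zero {f : ℝ → ℝ} (hf : Continuous f) {a b : ℝ} (hab : a ≤ b)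
    (ha : 0 < f a) (hb : f b < 0) :
    ∃ c, a < c ∧ f c = 0 ∧ ∀ u, a ≤ u → u < c → 0 < f u := by
  obtain ⟨c, ⟨⟨hac, hcb⟩, hc⟩, hleast⟩ :=
    (isCompact_Icc.inter_right (isClosed_le hf continuous_const)).exists_isLeast
      (s := Set.Icc a b ∩ {u | f u ≤ 0}) ⟨b, ⟨hab, le_rfl⟩, hb.le⟩
  have hc' : f c ≤ 0 := hc
  obtain ⟨d, ⟨had, hdc⟩, hd⟩ :=
    intermediate_value_Icc' hac hf.continuousOn (show (0 : ℝ) ∈ Set.Icc (f c) (f a) from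
      ⟨hc', ha.le⟩)
  have hcd : c ≤ d := hleast ⟨⟨had, hdc.trans hcb⟩, hd.le⟩
  have hc0 : f c = 0 := le_antisymm hcd hdc ▸ hd
  refine ⟨c, hac.lt_of_ne ?_, hc0, fun u hau huc => ?_⟩
  · rintro rfl
    exact ha.ne' hc0
  · by_contra! h
    exact huc.not_ge (hleast ⟨⟨hau, huc.le.trans hcb⟩, h⟩)


/-- **Existence of the support function.** For every continuous positive function `ρ`
there are `u₁ > 0` and a twice continuously differentiable function `p` with
`p + p'' = ρ` on `[0, u₁]`, `p 0 = 0`, `p u₁ = 0`, and `p > 0` on `(0, u₁)`. -/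
theorem support_function_exists (ρ : ℝ → ℝ) (hρc : Continuous ρ)
    (hρ : ∀ u : ℝ, 0 < ρ u) :
    ∃ u₁ : ℝ, 0 < u₁ ∧ ∃ p : ℝ → ℝ, ContDiff ℝ 2 p ∧
      (∀ u ∈ Set.Icc 0 u₁, p u + deriv (deriv p) u = ρ u) ∧
      p 0 = 0 ∧ p u₁ = 0 ∧ ∀ u ∈ Set.Ioo 0 u₁, 0 < p u := by
  set q : ℝ := ∫ t in (0 : ℝ)..(Real.pi + Real.pi / 2),
    Real.sin (Real.pi + Real.pi / 2 - t) * ρ t with hq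
  have hπ := Real.pi_pos
  have ha : 0 ≤ |q| + 1 := by positivity
  have hneg : supportSolution ρ (|q| + 1) (Real.pi + Real.pi / 2) < 0 := by
    have hsin : Real.sin (Real.pi + Real.pi / 2) = -1 := by
      rw [add_comm, Real.sin_add_pi, Real.sin_pi_div_two]
    rw [supportSolution_eq hρc, ← hq, hsin]
    linarith [le_abs_self q]
  obtain ⟨u₁, hπu, hu₁, hpos⟩ := exists_first_zero
    (continuous_supportSolution hρc (|q| + 1)) (by linarith)
    (supportSolution_pos hρc hρ ha hπ le_rfl) hneg
  refine ⟨u₁, hπ.trans hπu, supportSolution ρ (|q| + 1), contDiff_supportSolution hρc _,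
    fun u _ => ?_, by simp [supportSolution], hu₁, fun u hu => ?_⟩
  · rw [deriv_supportSolution hρc, deriv_supportSolutionDeriv hρc]
    ring
  · rcases le_total u Real.pi with h | h
    · exact supportSolution_pos hρc hρ ha hu.1 h
    · exact hpos u h hu.2
end

section
/- Let r₁, r₂, ψ be real numbers with 0 < r₁ < r₂ and 0 < ψ < π/2. Then there exists a nonzero polynomial G with real positive coefficients such that for every r with r₁ < r < r₂ and every φ with ψ < φ ≤ π, the product (X² − 2r·cos(φ)·X + r²) · G has positive coefficients. -/
open Polynomial

/-- The polynomial `∑ i ≤ N, A ^ i c ^ (i (i - 1) / 2) X ^ i`, whose consecutive coefficient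
ratios form a geometric progression with ratio `c`. -/
noncomputable def geomRatioPoly (A c : ℝ) (N : ℕ) : Polynomial ℝ :=
  ∑ i ∈ Finset.range (N + 1), monomial i (∏ j ∈ Finset.range i, A * c ^ j)

theorem coeff_geomRatioPoly (A c : ℝ) (N k : ℕ) :
    (geomRatioPoly A c N).coeff k =
      if k ≤ N then ∏ j ∈ Finset.range k, A * c ^ j else 0 := by
  simp [geomRatioPoly, coeff_monomial]

theorem natDegree_geomRatioPoly_le (A c : ℝ) (N : ℕ) :
    (geomRatioPoly A c N).natDegree ≤ N := by
  rw [natDegree_le_iff_coeff_eq_zero]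
  intro k hk
  rw [coeff_geomRatioPoly, if_neg (by omega)]

theorem one_sub_two_mul_add_sq_pos {c d t : ℝ} (hc : 0 < c) (hc1 : c < 1) (hd : d < c)
    (ht : 0 < t) : 0 < 1 - 2 * d * t + c * t ^ 2 := by
  nlinarith [sq_nonneg (1 - c * t), mul_pos (mul_pos hc (sub_pos.2 hc1)) (pow_pos ht 2),
    mul_pos (sub_pos.2 hd) ht]

theorem posCoeffs_quadratic_mul_geomRatioPoly {A c r d : ℝ} {n : ℕ} (hA : 0 < A) (hc : 0 < c)
    (hc1 : c < 1) (hr : 0 < r) (hd : d < c) (hlow : 2 * c < r * A)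
    (hhigh : 2 * r * c * (A * c ^ n) < 1) :
    PosCoeffs ((X ^ 2 - C (2 * r * d) * X + C (r ^ 2)) * geomRatioPoly A c (n + 1)) := by
  have hg : ∀ k, 0 < ∏ j ∈ Finset.range k, A * c ^ j := fun k =>
    Finset.prod_pos fun j _ => by positivity
  have hdeg : ((X ^ 2 - C (2 * r * d) * X + C (r ^ 2)) *
      geomRatioPoly A c (n + 1)).natDegree ≤ n + 3 := by
    refine natDegree_mul_le.trans ?_
    have hq : (X ^ 2 - C (2 * r * d) * X + C (r ^ 2)).natDegree ≤ 2 := by compute_degree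
    have := natDegree_geomRatioPoly_le A c (n + 1)
    omega
  intro i hi
  replace hi := hi.trans hdeg
  rw [add_mul, sub_mul, mul_assoc, coeff_add, coeff_sub, coeff_C_mul, coeff_C_mul, coeff_X_pow_mul']
  match i with
  | 0 =>
    simp only [mul_coeff_zero, coeff_X_zero, coeff_geomRatioPoly]
    simp
    positivity
  | 1 =>
    have h : 0 < r * (r * A - 2 * d) := mul_pos hr (by linarith)
    simp [coeff_X_mul, coeff_geomRatioPoly]
    nlinarith
  | k + 2 =>
    have hk := hg k
    simp only [coeff_X_mul, coeff_geomRatioPoly, Nat.le_add_left, if_true, Nat.add_sub_cancel]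
    rw [if_pos (by omega : k ≤ n + 1)]
    rcases lt_trichotomy k n with h | rfl | h
    · rw [if_pos (by omega), if_pos (by omega), Finset.prod_range_succ _ (k + 1), Finset.prod_range_succ _ k]
      have := mul_pos hk (one_sub_two_mul_add_sq_pos hc hc1 hd
        (by positivity : 0 < r * (A * c ^ k)))
      refine this.trans_eq ?_
      ring
    · rw [if_pos (by omega), if_neg (by omega), Finset.prod_range_succ]
      have hdc : 2 * r * d * (A * c ^ k) ≤ 2 * r * c * (A * c ^ k) := by gcongr
      have := mul_pos hk (by linarith : 0 < 1 - 2 * r * d * (A * c ^ k))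
      refine this.trans_eq ?_
      ring
    · rw [if_neg (by omega), if_neg (by omega)]
      simpa using hk

/-- **Representation factor of a circular split region.** Given `0 < r₁ < r₂` and
`0 < ψ < π/2`, there is a nonzero polynomial `G` with positive coefficients, depending
only on `r₁, r₂, ψ`, such that for every quadratic `X² − 2r cos(φ) X + r²` whose roots
`r e^{±iφ}` lie in the region (`r₁ < r < r₂`, `ψ < φ ≤ π`), the product
`(X² − 2r cos(φ) X + r²) · G` has positive coefficients. -/
theorem representation_factor_exists (r₁ r₂ ψ : ℝ)
    (h₁ : 0 < r₁) (h₂ : r₁ < r₂) (hψ₀ : 0 < ψ) (hψ₁ : ψ < Real.pi / 2) :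
    ∃ G : Polynomial ℝ, G ≠ 0 ∧ PosCoeffs G ∧
      ∀ r φ : ℝ, r₁ < r → r < r₂ → ψ < φ → φ ≤ Real.pi →
        PosCoeffs ((X ^ 2 - C (2 * r * Real.cos φ) * X + C (r ^ 2)) * G) := by
  have hc : 0 < Real.cos ψ := Real.cos_pos_of_mem_Ioo ⟨by linarith, hψ₁⟩
  have hc1 : Real.cos ψ < 1 := by
    simpa using Real.cos_lt_cos_of_nonneg_of_le_pi le_rfl (by linarith [Real.pi_pos]) hψ₀
  set c := Real.cos ψ
  have h₂' : 0 < r₂ := h₁.trans h₂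
  set A := 2 / r₁ with hAdef
  have hA : 0 < A := by positivity
  have hr₁A : r₁ * A = 2 := by rw [hAdef]; field_simp
  obtain ⟨n, hn⟩ := exists_pow_lt_of_lt_one
    (by positivity : 0 < 1 / (2 * r₂ * c * A)) hc1
  rw [lt_div_iff₀ (by positivity)] at hn
  have hpos : PosCoeffs (geomRatioPoly A c (n + 1)) := by
    intro i hi
    rw [coeff_geomRatioPoly, if_pos (hi.trans (natDegree_geomRatioPoly_le A c (n + 1)))]
    exact Finset.prod_pos fun j _ => by positivity
  refine ⟨geomRatioPoly A c (n + 1), ?_, hpos, ?_⟩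
  · intro h
    have := hpos 0 (Nat.zero_le _)
    simp [h] at this
  · intro r φ hr₁ hr₂ hφ hφπ
    have hr : 0 < r := h₁.trans hr₁
    refine posCoeffs_quadratic_mul_geomRatioPoly hA hc hc1 hr
      (Real.cos_lt_cos_of_nonneg_of_le_pi hψ₀.le hφπ hφ) ?_ ?_
    · have := mul_lt_mul_of_pos_right hr₁ hA
      linarith
    · have : 2 * r * c * (A * c ^ n) ≤ 2 * r₂ * c * (A * c ^ n) := by gcongr
      linarith
end

section
/- Let f(x, y) = x·(y − 1)² + 1 as a polynomial in two variables with real coefficients. Then (a) f(x₀, y₀) ≥ 1 for all real x₀ ≥ 0 and y₀ ≥ 0 (in particular f is strictly positive on the closed positive quadrant), and (b) there do NOT exist nonzero polynomials f₁, f₂ in x and y with real nonnegative coefficients such that f·f₁ = f₂. -/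
open Polynomial

/- We represent polynomials in two variables `x, y` as elements of
`Polynomial (Polynomial ℝ)`: the outer variable is `x`, the inner variable is `y`.
Evaluation at `(x₀, y₀)` is `Polynomial.eval y₀ (Polynomial.eval (Polynomial.C x₀) f)`. -/

/-- A polynomial with nonnegative coefficients that vanishes at `1` is zero. -/
theorem eq_zero_of_coeff_nonneg_of_eval_one_eq_zero {p : Polynomial ℝ}
    (hp : ∀ j, 0 ≤ p.coeff j) (h : p.eval 1 = 0) : p = 0 := by
  rw [Polynomial.eval_eq_sum_range] at h
  simp only [one_pow, mul_one] at h
  rw [Finset.sum_eq_zero_iff_of_nonneg fun j _ => hp j] at h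
  exact Polynomial.leadingCoeff_eq_zero.mp (h p.natDegree (Finset.self_mem_range_succ _))

/-- **Meissner's counterexample.** The polynomial `f(x,y) = x(y−1)² + 1` satisfies
`f(x₀, y₀) ≥ 1` on the closed positive quadrant (so it is strictly positive there),
and yet it admits no positive representation: there are no nonzero two-variable
polynomials `f₁, f₂` with nonnegative coefficients such that `f·f₁ = f₂`. -/
theorem counterexample_no_positive_representation
    (f : Polynomial (Polynomial ℝ))
    (hf : f = Polynomial.C ((Polynomial.X - 1) ^ 2) * Polynomial.X + 1) :
    (∀ x₀ y₀ : ℝ, 0 ≤ x₀ → 0 ≤ y₀ →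
      1 ≤ Polynomial.eval y₀ (Polynomial.eval (Polynomial.C x₀) f)) ∧
    ¬ ∃ f₁ f₂ : Polynomial (Polynomial ℝ), f₁ ≠ 0 ∧ f₂ ≠ 0 ∧
        (∀ i j : ℕ, 0 ≤ (f₁.coeff i).coeff j) ∧
        (∀ i j : ℕ, 0 ≤ (f₂.coeff i).coeff j) ∧
        f * f₁ = f₂ := by
  subst hf
  refine ⟨fun x₀ y₀ hx _ => ?_, ?_⟩
  · simp only [eval_add, eval_mul, eval_C, eval_X, eval_one, eval_pow, eval_sub]
    linarith [mul_nonneg (sq_nonneg (y₀ - 1)) hx]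
  · rintro ⟨f₁, f₂, hf₁, -, -, hnonneg, rfl⟩
    have hcoeff : ((C ((X - 1) ^ 2) * X + 1) * f₁).coeff (f₁.natDegree + 1) =
        (X - 1) ^ 2 * f₁.leadingCoeff := by
      rw [add_mul, one_mul, mul_assoc, coeff_add, coeff_C_mul, coeff_X_mul,
        coeff_eq_zero_of_natDegree_lt (Nat.lt_succ_self _), add_zero, leadingCoeff]
    have hzero : (X - 1) ^ 2 * f₁.leadingCoeff = 0 :=
      eq_zero_of_coeff_nonneg_of_eval_one_eq_zero
        (fun j => hcoeff ▸ hnonneg (f₁.natDegree + 1) j) (by simp)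
    have hX : (X - 1 : Polynomial ℝ) ≠ 0 := X_sub_C_ne_zero 1
    exact mul_ne_zero (pow_ne_zero 2 hX) (leadingCoeff_ne_zero.mpr hf₁) hzero
end
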